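/- Let α ∈ (0,1), and define E_{α,α}(x) := ∑_{k=0}^∞ x^k · (Γ(α k + α))⁻¹ for x ∈ ℝ. Then there exists C > 0, depending only on α, such that for every sequence (λ_k)_{k∈ℕ} of positive reals, every real sequence (a_k)_{k∈ℕ} with ∑_k a_k² < ∞, and every t > 0, one has ∑_{k} λ_k^{7/4} · (t^{α-1} E_{α,α}(-λ_k t^α))² · a_k² ≤ C t^{α/4 - 2} ∑_{k} a_k². -/

import Mathlib

open Real

open MeasureTheory Filter Topology FourierTransform

lemma integrableOn_rpow_mul_exp_neg_mul {p b : ℝ} (hp : -1 < p) (hb : 0 < b) :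
    IntegrableOn (fun t : ℝ => t ^ p * rexp (-(b * t))) (Set.Ioi 0) := by
  simpa [neg_mul] using integrableOn_rpow_mul_exp_neg_mul_rpow (s := p) (p := 1) hp one_pos hb

lemma differentiableOn_laplace_rpow {p : ℝ} (hp : -1 < p) :
    DifferentiableOn ℂ (fun s : ℂ => ∫ t in Set.Ioi (0 : ℝ), ((t ^ p : ℝ) : ℂ) * Complex.exp (-(s * t)))
      {s : ℂ | 0 < s.re} := by
  intro s hs
  have hs' : 0 < s.re := hs
  have hmeas : ∀ (q : ℝ) (z : ℂ), AEStronglyMeasurable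
      (fun t : ℝ => ((t ^ q : ℝ) : ℂ) * Complex.exp (-(z * t))) (volume.restrict (Set.Ioi 0)) := by
    intro q z
    exact Measurable.aestronglyMeasurable (by fun_prop)
  have hnorm : ∀ (q : ℝ) (z : ℂ) (t : ℝ), 0 < t →
      ‖((t ^ q : ℝ) : ℂ) * Complex.exp (-(z * t))‖ = t ^ q * rexp (-(z.re * t)) := by
    intro q z t ht
    rw [norm_mul, Complex.norm_real, Complex.norm_exp, Real.norm_of_nonneg (rpow_nonneg ht.le _)]
    simp
  have key := hasDerivAt_integral_of_dominated_loc_of_deriv_le (𝕜 := ℂ)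
    (μ := volume.restrict (Set.Ioi (0 : ℝ)))
    (F := fun (z : ℂ) (t : ℝ) => ((t ^ p : ℝ) : ℂ) * Complex.exp (-(z * t)))
    (F' := fun (z : ℂ) (t : ℝ) => -(((t ^ (p + 1) : ℝ) : ℂ) * Complex.exp (-(z * t))))
    (bound := fun t : ℝ => t ^ (p + 1) * rexp (-(s.re / 2 * t)))
    (x₀ := s) (s := {z : ℂ | s.re / 2 < z.re})
    ((isOpen_lt continuous_const Complex.continuous_re).mem_nhds (by simp; linarith))
    (Eventually.of_forall fun z => hmeas p z)
    ?_ (hmeas (p + 1) s).neg ?_ (integrableOn_rpow_mul_exp_neg_mul (by linarith) (by linarith)) ?_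
  · exact key.2.differentiableAt.differentiableWithinAt
  · refine (integrableOn_rpow_mul_exp_neg_mul hp hs').mono' (hmeas p s) ?_
    filter_upwards [ae_restrict_mem measurableSet_Ioi] with t ht
    exact (hnorm p s t ht).le
  · filter_upwards [ae_restrict_mem measurableSet_Ioi] with t ht z hz
    have ht' : 0 < t := ht
    have hz' : s.re / 2 < z.re := hz
    rw [norm_neg, hnorm _ _ _ ht]
    gcongr
  · filter_upwards [ae_restrict_mem measurableSet_Ioi] with t ht z hz
    have ht' : 0 < t := ht
    have h1 : HasDerivAt (fun z : ℂ => -(z * t)) (-(t : ℂ)) z := by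
      simpa using ((hasDerivAt_id z).mul_const (t : ℂ)).fun_neg
    convert! (h1.cexp.const_mul ((t ^ p : ℝ) : ℂ)) using 1
    rw [rpow_add_one ht'.ne']
    push_cast
    ring

lemma laplace_rpow {β : ℝ} (hβ : 0 < β) {s : ℂ} (hs : 0 < s.re) :
    ∫ t in Set.Ioi (0 : ℝ), ((t ^ (β - 1) : ℝ) : ℂ) * Complex.exp (-(s * t)) =
      Real.Gamma β * s ^ (-β : ℂ) := by
  have hopen : IsOpen {s : ℂ | 0 < s.re} := isOpen_lt continuous_const Complex.continuous_re
  have h1 := (differentiableOn_laplace_rpow (p := β - 1) (by linarith)).analyticOnNhd hopen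
  have h2 : AnalyticOnNhd ℂ (fun s : ℂ => (Real.Gamma β : ℂ) * s ^ (-β : ℂ)) {s : ℂ | 0 < s.re} := by
    refine DifferentiableOn.analyticOnNhd (fun z hz => ?_) hopen
    refine DifferentiableAt.differentiableWithinAt ?_
    exact (DifferentiableAt.cpow_const differentiableAt_id (Or.inl hz)).const_mul _
  refine h1.eqOn_of_preconnected_of_frequently_eq h2 (convex_halfSpace_re_gt 0).isPreconnected
    (z₀ := 1) (by simp) ?_ hs
  have hreal : ∀ r : ℝ, 0 < r →
      ∫ t in Set.Ioi (0 : ℝ), ((t ^ (β - 1) : ℝ) : ℂ) * Complex.exp (-((r : ℂ) * t)) =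
      Real.Gamma β * (r : ℂ) ^ (-β : ℂ) := by
    intro r hr
    have := Real.integral_rpow_mul_exp_neg_mul_Ioi hβ hr
    have h3 : (r : ℂ) ^ (-β : ℂ) = (((1 / r) ^ β : ℝ) : ℂ) := by
      rw [one_div, inv_rpow hr.le, ← rpow_neg hr.le, Complex.ofReal_cpow hr.le]
      simp
    rw [h3, mul_comm, ← Complex.ofReal_mul, ← this, ← integral_complex_ofReal]
    simp
  have htend : Tendsto (fun r : ℝ => (r : ℂ)) (𝓝[>] 1) (𝓝[≠] 1) := by
    refine tendsto_nhdsWithin_of_tendsto_nhds_of_eventually_within _ ?_ ?_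
    · exact (Complex.continuous_ofReal.tendsto' 1 1 (by simp)).mono_left nhdsWithin_le_nhds
    · filter_upwards [self_mem_nhdsWithin] with r hr
      have : (1 : ℝ) < r := hr
      simp
      exact_mod_cast this.ne'
  refine htend.frequently (Eventually.frequently ?_)
  filter_upwards [self_mem_nhdsWithin] with r hr
  exact hreal r (lt_trans one_pos hr)

/-- The vertical line `Re s = 1`, parametrised so that Fourier inversion has no extra factor. -/
noncomputable def verticalLine (ξ : ℝ) : ℂ := 1 + 2 * π * ξ * Complex.I

lemma verticalLine_re (ξ : ℝ) : (verticalLine ξ).re = 1 := by simp [verticalLine]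

lemma continuous_verticalLine : Continuous verticalLine := by unfold verticalLine; fun_prop

lemma verticalLine_ne_zero (ξ : ℝ) : verticalLine ξ ≠ 0 := fun h => by
  simpa [h] using verticalLine_re ξ

lemma verticalLine_mem_slitPlane (ξ : ℝ) : verticalLine ξ ∈ Complex.slitPlane :=
  Or.inl (by simp [verticalLine_re])

lemma one_le_norm_verticalLine (ξ : ℝ) : 1 ≤ ‖verticalLine ξ‖ := by
  simpa [verticalLine_re] using Complex.re_le_norm (verticalLine ξ)

lemma norm_exp_verticalLine (ξ : ℝ) : ‖Complex.exp (verticalLine ξ)‖ = rexp 1 := by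
  rw [Complex.norm_exp, verticalLine_re]

lemma continuous_verticalLine_cpow (c : ℂ) : Continuous fun ξ => verticalLine ξ ^ c :=
  continuous_verticalLine.cpow continuous_const verticalLine_mem_slitPlane

lemma norm_verticalLine_cpow (ξ c : ℝ) : ‖verticalLine ξ ^ (c : ℂ)‖ = ‖verticalLine ξ‖ ^ c :=
  Complex.norm_cpow_real _ _

lemma integrable_norm_verticalLine_rpow {β : ℝ} (hβ : 1 < β) :
    Integrable fun ξ => ‖verticalLine ξ‖ ^ (-β) := by
  have h := integrable_rpow_neg_one_add_norm_sq (E := ℝ) (μ := volume) (r := β) (by simpa using hβ)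
  refine h.mono' ?_ (Eventually.of_forall fun ξ => ?_)
  · exact (continuous_verticalLine.norm.rpow_const fun ξ =>
      Or.inl (norm_ne_zero_iff.2 (verticalLine_ne_zero ξ))).aestronglyMeasurable
  · rw [Real.norm_of_nonneg (by positivity)]
    have hsq : 1 + ‖ξ‖ ^ 2 ≤ ‖verticalLine ξ‖ ^ 2 := by
      rw [← Complex.normSq_eq_norm_sq, Complex.normSq_apply]
      simp [verticalLine]
      nlinarith [pi_gt_three, mul_nonneg (by nlinarith [pi_gt_three] : 0 ≤ 4 * π ^ 2 - 1) (sq_nonneg ξ)]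
    calc ‖verticalLine ξ‖ ^ (-β) = (‖verticalLine ξ‖ ^ 2) ^ (-β / 2) := by
          rw [← rpow_natCast, ← rpow_mul (norm_nonneg _)]
          congr 1; push_cast; ring
      _ ≤ (1 + ‖ξ‖ ^ 2) ^ (-β / 2) := rpow_le_rpow_of_nonpos (by positivity) hsq (by linarith)

lemma integral_exp_mul_verticalLine_cpow {β : ℝ} (hβ : 1 < β) :
    ∫ ξ, Complex.exp (verticalLine ξ) * verticalLine ξ ^ (-β : ℂ) = ((Real.Gamma β)⁻¹ : ℝ) := by
  set f : ℝ → ℂ := (Set.Ioi (0 : ℝ)).indicator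
    fun t => ((t ^ (β - 1) : ℝ) : ℂ) * Complex.exp (-t) with hf
  have hF : 𝓕 f = fun ξ => (Real.Gamma β : ℂ) * verticalLine ξ ^ (-β : ℂ) := by
    ext ξ
    rw [← laplace_rpow (by linarith) (by simp [verticalLine_re]), Real.fourier_eq',
      ← integral_indicator measurableSet_Ioi]
    congr 1 with t
    by_cases ht : t ∈ Set.Ioi (0 : ℝ)
    · simp only [hf, Set.indicator_of_mem ht, smul_eq_mul]
      rw [mul_left_comm, ← Complex.exp_add]
      congr 2
      simp [verticalLine]
      ring
    · simp [hf, Set.indicator_of_notMem ht]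
  have hint : Integrable f := by
    rw [hf, integrable_indicator_iff measurableSet_Ioi]
    have := (integrableOn_rpow_mul_exp_neg_mul (p := β - 1) (by linarith) one_pos).ofReal (𝕜 := ℂ)
    simpa [IntegrableOn] using this
  have hFint : Integrable (𝓕 f) := by
    rw [hF]
    refine Integrable.const_mul ?_ _
    refine (integrable_norm_verticalLine_rpow hβ).mono'
      (continuous_verticalLine_cpow _).aestronglyMeasurable (Eventually.of_forall fun ξ => ?_)
    exact_mod_cast (norm_verticalLine_cpow ξ (-β)).le
  have hcont : ContinuousAt f 1 := by
    have : f =ᶠ[𝓝 1] fun t => ((t ^ (β - 1) : ℝ) : ℂ) * Complex.exp (-t) := by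
      filter_upwards [Ioi_mem_nhds (zero_lt_one' ℝ)] with t ht
      simp only [hf, Set.indicator_of_mem ht]
    refine ContinuousAt.congr ?_ this.symm
    have h1 : ContinuousAt (fun t : ℝ => t ^ (β - 1)) 1 :=
      continuousAt_rpow_const _ _ (Or.inl one_ne_zero)
    fun_prop
  have h := hint.fourierInv_fourier_eq hFint hcont
  have hΓ : (Real.Gamma β : ℂ) ≠ 0 := by exact_mod_cast (Gamma_pos_of_pos (by linarith)).ne'
  rw [Real.fourierInv_eq', hF] at h
  have hf1 : f 1 = Complex.exp (-1) := by simp [hf]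
  rw [hf1] at h
  have h2 : ∀ ξ : ℝ, Complex.exp (verticalLine ξ) * verticalLine ξ ^ (-β : ℂ) =
      (Complex.exp 1 * (Real.Gamma β : ℂ)⁻¹) * (Complex.exp (↑(2 * π * inner ℝ ξ 1) * Complex.I) •
        ((Real.Gamma β : ℂ) * verticalLine ξ ^ (-β : ℂ))) := by
    intro ξ
    have : Complex.exp (verticalLine ξ) =
        Complex.exp 1 * Complex.exp (↑(2 * π * inner ℝ ξ 1) * Complex.I) := by
      rw [← Complex.exp_add]
      simp [verticalLine]
    rw [this, smul_eq_mul]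
    field_simp
  simp_rw [h2]
  rw [integral_const_mul, h, mul_right_comm, ← Complex.exp_add]
  simp

lemma inv_Gamma_le {β R : ℝ} (hβ : 0 < β) (hR : 0 < R) :
    (Real.Gamma β)⁻¹ ≤ β * (rexp R * R ^ (-β)) := by
  have hΓ := Real.Gamma_pos_of_pos hβ
  have hlow : R ^ β * rexp (-R) ≤ Real.Gamma (β + 1) := by
    rw [Real.Gamma_eq_integral (by linarith), ← integral_exp_neg_Ioi R, ← integral_const_mul]
    simp only [add_sub_cancel_right]
    have hconv : IntegrableOn (fun x : ℝ => rexp (-x) * x ^ β) (Set.Ioi 0) := by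
      simpa using Real.GammaIntegral_convergent (s := β + 1) (by linarith)
    have hsub : Set.Ioi R ⊆ Set.Ioi 0 := Set.Ioi_subset_Ioi hR.le
    calc ∫ x in Set.Ioi R, R ^ β * rexp (-x) ≤ ∫ x in Set.Ioi R, rexp (-x) * x ^ β := by
          refine setIntegral_mono_on ((integrableOn_exp_neg_Ioi R).const_mul _)
            (hconv.mono_set hsub) measurableSet_Ioi fun x hx => ?_
          have hx' : R < x := hx
          rw [mul_comm]
          gcongr
      _ ≤ _ := by
          refine setIntegral_mono_set hconv ?_ hsub.eventuallyLE
          filter_upwards [ae_restrict_mem measurableSet_Ioi] with x hx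
          have hx' : 0 < x := hx
          simp only [Pi.zero_apply]
          positivity
  rw [Real.Gamma_add_one hβ.ne'] at hlow
  rw [inv_le_iff_one_le_mul₀ hΓ, rpow_neg hR.le]
  have hRβ : 0 < R ^ β := rpow_pos_of_pos hR _
  have h1 : (rexp R * (R ^ β)⁻¹) * (R ^ β * rexp (-R)) = 1 := by
    rw [Real.exp_neg]
    field_simp
  calc (1 : ℝ) = (rexp R * (R ^ β)⁻¹) * (R ^ β * rexp (-R)) := h1.symm
    _ ≤ (rexp R * (R ^ β)⁻¹) * (β * Real.Gamma β) := by gcongr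
    _ = _ := by ring

/-- The Mittag-Leffler function `E_{α,α}` on the complex plane. -/
noncomputable def mittagLeffler (α : ℝ) (z : ℂ) : ℂ :=
  ∑' k : ℕ, z ^ k * (((Real.Gamma (α * k + α))⁻¹ : ℝ) : ℂ)

lemma differentiable_mittagLeffler {α : ℝ} (hα : 0 < α) : Differentiable ℂ (mittagLeffler α) := by
  intro z
  set M : ℝ := ‖z‖ + 1 with hM
  have hM0 : 0 < M := by positivity
  set R : ℝ := (2 * M) ^ α⁻¹ with hR
  have hR0 : 0 < R := by positivity
  have hRα : R ^ α = 2 * M := by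
    rw [hR, ← rpow_mul (by positivity), inv_mul_cancel₀ hα.ne', rpow_one]
  have hsum : Summable fun k : ℕ => (α * rexp R * (2 * M)⁻¹) * (((k : ℝ) + 1) * (1 / 2) ^ k) := by
    refine Summable.mul_left _ ?_
    simp_rw [add_mul, one_mul]
    refine Summable.add ?_ summable_geometric_two
    simpa using summable_pow_mul_geometric_of_norm_lt_one (R := ℝ) 1 (r := 1 / 2) (by norm_num)
  refine (Complex.differentiableOn_tsum_of_summable_norm (U := Metric.ball 0 M) hsum
    (fun k => by fun_prop) Metric.isOpen_ball fun k w hw => ?_).differentiableAt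
    (Metric.isOpen_ball.mem_nhds (by simp [hM]))
  have hw' : ‖w‖ ≤ M := by simpa using (Metric.mem_ball.1 hw).le
  have hβ : 0 < α * k + α := by positivity
  have hRk : R ^ (-(α * k + α)) = ((2 * M) ^ (k + 1))⁻¹ := by
    rw [rpow_neg hR0.le, show α * k + α = α * ((k + 1 : ℕ) : ℝ) by push_cast; ring,
      rpow_mul hR0.le, hRα, rpow_natCast]
  rw [norm_mul, norm_pow, Complex.norm_real,
    Real.norm_of_nonneg (inv_nonneg.2 (Real.Gamma_pos_of_pos hβ).le)]
  calc ‖w‖ ^ k * (Real.Gamma (α * k + α))⁻¹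
      ≤ M ^ k * ((α * k + α) * (rexp R * R ^ (-(α * k + α)))) := by
        gcongr
        exact inv_Gamma_le hβ hR0
    _ = _ := by
        rw [hRk, mul_pow, pow_succ M, pow_succ 2, one_div, inv_pow]
        field_simp

lemma mittagLeffler_ofReal (α x : ℝ) :
    mittagLeffler α x = ((∑' k : ℕ, x ^ k * (Real.Gamma (α * k + α))⁻¹ : ℝ) : ℂ) := by
  simp [mittagLeffler, Complex.ofReal_tsum]

lemma cos_mul_norm_le_re_verticalLine_cpow {α : ℝ} (hα : α ∈ Set.Ioo (0 : ℝ) 1) (ξ : ℝ) :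
    Real.cos (α * (π / 2)) * ‖verticalLine ξ ^ (α : ℂ)‖ ≤ (verticalLine ξ ^ (α : ℂ)).re := by
  have harg : |(verticalLine ξ).arg| < π / 2 :=
    Complex.abs_arg_lt_pi_div_two_iff.2 (Or.inl (by simp [verticalLine_re]))
  have hre : (verticalLine ξ ^ (α : ℂ)).re =
      ‖verticalLine ξ ^ (α : ℂ)‖ * Real.cos (α * |(verticalLine ξ).arg|) := by
    rw [norm_verticalLine_cpow, Complex.cpow_ofReal_re, ← Real.cos_abs, abs_mul,
      abs_of_pos hα.1, mul_comm α]
  rw [hre, mul_comm]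
  have := abs_nonneg (verticalLine ξ).arg
  gcongr
  refine Real.cos_le_cos_of_nonneg_of_le_pi (mul_nonneg hα.1.le this) ?_ ?_
  · nlinarith [hα.1, hα.2, pi_pos]
  · exact mul_le_mul_of_nonneg_left harg.le hα.1.le

lemma re_verticalLine_cpow_pos {α : ℝ} (hα : α ∈ Set.Ioo (0 : ℝ) 1) (ξ : ℝ) :
    0 < (verticalLine ξ ^ (α : ℂ)).re := by
  refine lt_of_lt_of_le (mul_pos ?_ ?_) (cos_mul_norm_le_re_verticalLine_cpow hα ξ)
  · apply Real.cos_pos_of_mem_Ioo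
    constructor <;> nlinarith [hα.1, hα.2, pi_pos]
  · rw [norm_pos_iff, Complex.cpow_ne_zero_iff]
    exact Or.inl (verticalLine_ne_zero ξ)

lemma exists_norm_verticalLine_cpow_le {α : ℝ} (hα : α ∈ Set.Ioo (0 : ℝ) 1) :
    ∃ K : ℝ, 0 < K ∧ ∀ (ξ : ℝ) (x : ℂ), 0 ≤ x.re →
      ‖verticalLine ξ ^ (α : ℂ)‖ ≤ K * ‖verticalLine ξ ^ (α : ℂ) + x‖ := by
  have hcos : 0 < Real.cos (α * (π / 2)) := by
    apply Real.cos_pos_of_mem_Ioo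
    constructor <;> nlinarith [hα.1, hα.2, pi_pos]
  refine ⟨(Real.cos (α * (π / 2)))⁻¹, inv_pos.2 hcos, fun ξ x hx => ?_⟩
  rw [le_inv_mul_iff₀ hcos]
  refine (cos_mul_norm_le_re_verticalLine_cpow hα ξ).trans ?_
  refine le_trans ?_ (Complex.re_le_norm _)
  simp [hx]

lemma one_le_norm_verticalLine_cpow {α : ℝ} (hα : 0 ≤ α) (ξ : ℝ) :
    1 ≤ ‖verticalLine ξ ^ (α : ℂ)‖ := by
  rw [norm_verticalLine_cpow]
  exact one_le_rpow (one_le_norm_verticalLine ξ) hα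

lemma verticalLine_cpow_add_ne_zero {α : ℝ} (hα : α ∈ Set.Ioo (0 : ℝ) 1) (ξ : ℝ) {x : ℂ}
    (hx : 0 ≤ x.re) : verticalLine ξ ^ (α : ℂ) + x ≠ 0 := fun h => by
  have := congrArg Complex.re h
  simp only [Complex.add_re, Complex.zero_re] at this
  linarith [re_verticalLine_cpow_pos hα ξ]

/-- The integrand representing `x E_{α,α}(-x) / α` as an integral over the line `Re s = 1`. -/
noncomputable def mittagLefflerKernel (α : ℝ) (x : ℂ) (ξ : ℝ) : ℂ :=
  Complex.exp (verticalLine ξ) * (verticalLine ξ)⁻¹ *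
    (x * verticalLine ξ ^ (α : ℂ) / (verticalLine ξ ^ (α : ℂ) + x) ^ 2)

lemma continuous_mittagLefflerKernel {α : ℝ} (hα : α ∈ Set.Ioo (0 : ℝ) 1) {x : ℂ} (hx : 0 ≤ x.re) :
    Continuous (mittagLefflerKernel α x) := by
  have h1 := continuous_verticalLine
  have h2 := continuous_verticalLine_cpow α
  unfold mittagLefflerKernel
  refine (h1.cexp.mul (h1.inv₀ verticalLine_ne_zero)).mul ?_
  exact (continuous_const.mul h2).div ((h2.add continuous_const).pow 2) fun ξ =>
    pow_ne_zero 2 (verticalLine_cpow_add_ne_zero hα ξ hx)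

lemma norm_verticalLine_inv_mul (ξ β : ℝ) :
    ‖verticalLine ξ‖⁻¹ * (‖verticalLine ξ‖ ^ β)⁻¹ = ‖verticalLine ξ‖ ^ (-(1 + β)) := by
  have h : 0 < ‖verticalLine ξ‖ := norm_pos_iff.2 (verticalLine_ne_zero ξ)
  rw [rpow_neg h.le, rpow_add h, rpow_one, mul_inv]

lemma differentiableOn_integral_mittagLefflerKernel {α : ℝ} (hα : α ∈ Set.Ioo (0 : ℝ) 1) :
    DifferentiableOn ℂ (fun x => ∫ ξ, mittagLefflerKernel α x ξ) {x : ℂ | 0 < x.re} := by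
  obtain ⟨K, hK0, hK⟩ := exists_norm_verticalLine_cpow_le hα
  have hopen : IsOpen {x : ℂ | 0 < x.re} := isOpen_lt continuous_const Complex.continuous_re
  intro x hx
  have hx' : 0 < x.re := hx
  have hbound_int : ∀ c : ℝ, Integrable fun ξ => c * ‖verticalLine ξ‖ ^ (-(1 + α)) := fun c =>
    (integrable_norm_verticalLine_rpow (by linarith [hα.1])).const_mul c
  have hq0 : ∀ ξ : ℝ, 0 < ‖verticalLine ξ ^ (α : ℂ)‖ := fun ξ =>
    one_pos.trans_le (one_le_norm_verticalLine_cpow hα.1.le ξ)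
  have hqx : ∀ (ξ : ℝ) (z : ℂ), 0 ≤ z.re → 0 < ‖verticalLine ξ ^ (α : ℂ) + z‖ := fun ξ z hz =>
    norm_pos_iff.2 (verticalLine_cpow_add_ne_zero hα ξ hz)
  have hfrac : ∀ (ξ : ℝ) (z : ℂ), 0 ≤ z.re → ‖verticalLine ξ ^ (α : ℂ)‖ /
      ‖verticalLine ξ ^ (α : ℂ) + z‖ ^ 2 ≤ K ^ 2 * ‖verticalLine ξ ^ (α : ℂ)‖⁻¹ := by
    intro ξ z hz
    rw [div_le_iff₀ (pow_pos (hqx ξ z hz) 2), mul_right_comm, ← mul_pow, le_mul_inv_iff₀ (hq0 ξ),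
      ← sq]
    exact pow_le_pow_left₀ (hq0 ξ).le (hK ξ z hz) 2
  have key := hasDerivAt_integral_of_dominated_loc_of_deriv_le (𝕜 := ℂ) (μ := volume)
    (F := mittagLefflerKernel α)
    (F' := fun (z : ℂ) (ξ : ℝ) => Complex.exp (verticalLine ξ) * (verticalLine ξ)⁻¹ *
      (verticalLine ξ ^ (α : ℂ) * (verticalLine ξ ^ (α : ℂ) - z) /
        (verticalLine ξ ^ (α : ℂ) + z) ^ 3))
    (bound := fun ξ => (rexp 1 * (1 + 2 * K) * K ^ 2) * ‖verticalLine ξ‖ ^ (-(1 + α)))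
    (x₀ := x) (s := {z : ℂ | 0 < z.re}) (hopen.mem_nhds hx)
    ?_ ?_ ?_ ?_ (hbound_int _) ?_
  · exact key.2.differentiableAt.differentiableWithinAt
  · filter_upwards [hopen.mem_nhds hx] with z hz
    exact (continuous_mittagLefflerKernel hα (le_of_lt hz)).aestronglyMeasurable
  · refine (hbound_int (rexp 1 * ‖x‖ * K ^ 2)).mono'
      (continuous_mittagLefflerKernel hα hx'.le).aestronglyMeasurable
      (Eventually.of_forall fun ξ => ?_)
    rw [mittagLefflerKernel, ← norm_verticalLine_inv_mul, ← norm_verticalLine_cpow]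
    simp only [norm_mul, norm_div, norm_pow, norm_inv, norm_exp_verticalLine]
    calc _ = rexp 1 * ‖verticalLine ξ‖⁻¹ * ‖x‖ * (‖verticalLine ξ ^ (α : ℂ)‖ /
          ‖verticalLine ξ ^ (α : ℂ) + x‖ ^ 2) := by ring
      _ ≤ rexp 1 * ‖verticalLine ξ‖⁻¹ * ‖x‖ * (K ^ 2 * ‖verticalLine ξ ^ (α : ℂ)‖⁻¹) := by
          gcongr
          exact hfrac ξ x hx'.le
      _ = _ := by ring
  · have h1 := continuous_verticalLine
    have h2 := continuous_verticalLine_cpow α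
    refine Continuous.aestronglyMeasurable ?_
    refine (h1.cexp.mul (h1.inv₀ verticalLine_ne_zero)).mul ?_
    exact (h2.mul (h2.sub continuous_const)).div ((h2.add continuous_const).pow 3) fun ξ =>
      pow_ne_zero 3 (verticalLine_cpow_add_ne_zero hα ξ hx'.le)
  · refine Eventually.of_forall fun ξ z hz => ?_
    have hz' : 0 ≤ z.re := le_of_lt hz
    rw [← norm_verticalLine_inv_mul, ← norm_verticalLine_cpow]
    simp only [norm_mul, norm_div, norm_pow, norm_inv, norm_exp_verticalLine]
    have hsub : ‖verticalLine ξ ^ (α : ℂ) - z‖ ≤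
        (1 + 2 * K) * ‖verticalLine ξ ^ (α : ℂ) + z‖ := by
      have h3 : verticalLine ξ ^ (α : ℂ) - z = (2 : ℂ) * verticalLine ξ ^ (α : ℂ) -
        (verticalLine ξ ^ (α : ℂ) + z) := by ring
      rw [h3]
      refine (norm_sub_le _ _).trans ?_
      rw [norm_mul, Complex.norm_two]
      linarith [hK ξ z hz']
    have hpos := hqx ξ z hz'
    calc _ = rexp 1 * ‖verticalLine ξ‖⁻¹ * (‖verticalLine ξ ^ (α : ℂ)‖ /
          ‖verticalLine ξ ^ (α : ℂ) + z‖ ^ 2) * (‖verticalLine ξ ^ (α : ℂ) - z‖ /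
          ‖verticalLine ξ ^ (α : ℂ) + z‖) := by field_simp
      _ ≤ rexp 1 * ‖verticalLine ξ‖⁻¹ * (K ^ 2 * ‖verticalLine ξ ^ (α : ℂ)‖⁻¹) * (1 + 2 * K) := by
          gcongr
          · exact hfrac ξ z hz'
          · rwa [div_le_iff₀ hpos]
      _ = _ := by ring
  · refine Eventually.of_forall fun ξ z hz => ?_
    have hne := verticalLine_cpow_add_ne_zero hα ξ (le_of_lt hz)
    have hden : HasDerivAt (fun z : ℂ => (verticalLine ξ ^ (α : ℂ) + z) ^ 2)
        (2 * (verticalLine ξ ^ (α : ℂ) + z)) z := by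
      simpa using ((hasDerivAt_id z).const_add (verticalLine ξ ^ (α : ℂ))).fun_pow 2
    have hnum : HasDerivAt (fun z : ℂ => z * verticalLine ξ ^ (α : ℂ))
        (verticalLine ξ ^ (α : ℂ)) z := by
      simpa using (hasDerivAt_id z).mul_const (verticalLine ξ ^ (α : ℂ))
    unfold mittagLefflerKernel
    convert! (hnum.div hden (pow_ne_zero 2 hne)).const_mul
      (Complex.exp (verticalLine ξ) * (verticalLine ξ)⁻¹) using 1
    field_simp
    ring

lemma hasSum_mittagLefflerKernel {α : ℝ} (hα : 0 ≤ α) {x : ℂ} (hx1 : ‖x‖ < 1) (ξ : ℝ) :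
    HasSum (fun k : ℕ => -(((k + 1 : ℕ) : ℂ) * (-x) ^ (k + 1)) *
      (Complex.exp (verticalLine ξ) * verticalLine ξ ^ (-((α * (k + 1 : ℕ) + 1 : ℝ) : ℂ))))
      (mittagLefflerKernel α x ξ) := by
  have hs := verticalLine_ne_zero ξ
  have hq1 := one_le_norm_verticalLine_cpow hα ξ
  set q := verticalLine ξ ^ (α : ℂ) with hq
  have hq0 : q ≠ 0 := norm_pos_iff.1 (one_pos.trans_le hq1)
  have hqx : q + x ≠ 0 := fun h => by
    rw [eq_neg_of_add_eq_zero_left h, norm_neg] at hq1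
    linarith
  have hr : ‖-x / q‖ < 1 := by
    rw [norm_div, norm_neg, div_lt_one (one_pos.trans_le hq1)]
    linarith
  have h1 := (hasSum_nat_add_iff' (f := fun n : ℕ => (n : ℂ) * (-x / q) ^ n) 1).2
    (hasSum_coe_mul_geometric_of_norm_lt_one hr)
  have h2 := h1.mul_left (-(Complex.exp (verticalLine ξ) * (verticalLine ξ)⁻¹))
  have hval : -(Complex.exp (verticalLine ξ) * (verticalLine ξ)⁻¹) *
      (-x / q / (1 - -x / q) ^ 2 - ∑ i ∈ Finset.range 1, (i : ℂ) * (-x / q) ^ i) =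
      mittagLefflerKernel α x ξ := by
    have h3 : 1 - -x / q = (q + x) / q := by field_simp; ring
    rw [h3, mittagLefflerKernel, ← hq]
    simp only [Finset.range_one, Finset.sum_singleton, Nat.cast_zero, zero_mul, sub_zero]
    field_simp
  rw [← hval]
  convert! h2 using 1
  ext k
  have hpow : verticalLine ξ ^ (-((α * (k + 1 : ℕ) + 1 : ℝ) : ℂ)) =
      (q ^ (k + 1))⁻¹ * (verticalLine ξ)⁻¹ := by
    rw [Complex.cpow_neg, Complex.ofReal_add, Complex.cpow_add _ _ hs, Complex.ofReal_one,
      Complex.cpow_one, mul_inv, hq, ← Complex.cpow_mul_nat, Complex.ofReal_mul,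
      Complex.ofReal_natCast]
  rw [hpow, div_pow]
  ring

lemma mul_integral_mittagLefflerKernel_of_norm_lt_one {α : ℝ} (hα : α ∈ Set.Ioo (0 : ℝ) 1) {x : ℂ}
    (hx1 : ‖x‖ < 1) :
    α * ∫ ξ, mittagLefflerKernel α x ξ = x * mittagLeffler α (-x) := by
  set g : ℕ → ℝ → ℂ := fun k ξ => -(((k + 1 : ℕ) : ℂ) * (-x) ^ (k + 1)) *
    (Complex.exp (verticalLine ξ) * verticalLine ξ ^ (-((α * (k + 1 : ℕ) + 1 : ℝ) : ℂ))) with hg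
  have hexp : ∀ k : ℕ, 1 + α ≤ α * (k + 1 : ℕ) + 1 := fun k => by
    push_cast; nlinarith [hα.1, (Nat.cast_nonneg k : (0 : ℝ) ≤ k)]
  have hgnorm : ∀ k ξ, ‖g k ξ‖ ≤
      (((k + 1 : ℕ) : ℝ) * ‖x‖ ^ (k + 1)) * (rexp 1 * ‖verticalLine ξ‖ ^ (-(1 + α))) := by
    intro k ξ
    simp only [hg]
    rw [norm_mul, norm_neg, norm_mul, norm_mul, norm_pow, norm_neg, norm_exp_verticalLine,
      ← Complex.ofReal_neg, norm_verticalLine_cpow, Complex.norm_natCast]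
    refine mul_le_mul_of_nonneg_left (mul_le_mul_of_nonneg_left ?_ (Real.exp_pos 1).le)
      (by positivity)
    exact rpow_le_rpow_of_exponent_le (one_le_norm_verticalLine ξ) (by linarith [hexp k])
  have hI : Integrable fun ξ => rexp 1 * ‖verticalLine ξ‖ ^ (-(1 + α)) :=
    (integrable_norm_verticalLine_rpow (by linarith [hα.1])).const_mul _
  have hgint : ∀ k, Integrable (g k) := fun k => by
    refine (hI.const_mul (((k + 1 : ℕ) : ℝ) * ‖x‖ ^ (k + 1))).mono' ?_
      (Eventually.of_forall (hgnorm k))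
    exact (continuous_const.mul (continuous_verticalLine.cexp.mul
      (continuous_verticalLine_cpow _))).aestronglyMeasurable
  have hsumm : Summable fun k => ∫ ξ, ‖g k ξ‖ := by
    have h0 : Summable fun n : ℕ => (n : ℝ) * ‖x‖ ^ n :=
      (hasSum_coe_mul_geometric_of_norm_lt_one (by simpa using hx1)).summable
    refine Summable.of_nonneg_of_le (fun k => integral_nonneg fun ξ => norm_nonneg _) (fun k => ?_)
      (((summable_nat_add_iff 1).2 h0).mul_right
        (∫ ξ, rexp 1 * ‖verticalLine ξ‖ ^ (-(1 + α))))
    rw [← integral_const_mul]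
    exact integral_mono (hgint k).norm (hI.const_mul _) (hgnorm k)
  have hpoint : ∀ ξ, ∑' k, g k ξ = mittagLefflerKernel α x ξ := fun ξ =>
    (hasSum_mittagLefflerKernel hα.1.le hx1 ξ).tsum_eq
  have hsum := (hasSum_integral_of_summable_integral_norm hgint hsumm).mul_left (α : ℂ)
  simp_rw [hpoint] at hsum
  rw [← hsum.tsum_eq, mittagLeffler, ← tsum_mul_left]
  congr 1 with k
  have hn : 0 < α * (k + 1 : ℕ) := mul_pos hα.1 (by positivity)
  have hΓ : (Real.Gamma (α * (k + 1 : ℕ)) : ℂ) ≠ 0 := by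
    exact_mod_cast (Real.Gamma_pos_of_pos hn).ne'
  have hα0 : (α : ℂ) ≠ 0 := by exact_mod_cast hα.1.ne'
  have hk0 : ((k : ℂ) + 1) ≠ 0 := by exact_mod_cast k.succ_ne_zero
  simp only [hg]
  rw [integral_const_mul, integral_exp_mul_verticalLine_cpow (by linarith),
    Real.Gamma_add_one hn.ne', show α * k + α = α * (k + 1 : ℕ) by push_cast; ring]
  push_cast at hΓ ⊢
  field_simp
  ring

lemma mul_integral_mittagLefflerKernel {α : ℝ} (hα : α ∈ Set.Ioo (0 : ℝ) 1) {x : ℂ}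
    (hx : 0 < x.re) :
    α * ∫ ξ, mittagLefflerKernel α x ξ = x * mittagLeffler α (-x) := by
  have hopen : IsOpen {x : ℂ | 0 < x.re} := isOpen_lt continuous_const Complex.continuous_re
  have h1 : AnalyticOnNhd ℂ (fun x : ℂ => α * ∫ ξ, mittagLefflerKernel α x ξ) {x | 0 < x.re} :=
    ((differentiableOn_integral_mittagLefflerKernel hα).const_mul _).analyticOnNhd hopen
  have h2 : AnalyticOnNhd ℂ (fun x : ℂ => x * mittagLeffler α (-x)) {x | 0 < x.re} := by
    have := differentiable_mittagLeffler hα.1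
    refine DifferentiableOn.analyticOnNhd (Differentiable.differentiableOn ?_) hopen
    fun_prop
  refine h1.eqOn_of_preconnected_of_eventuallyEq h2 (convex_halfSpace_re_gt 0).isPreconnected
    (z₀ := 1 / 2) (by norm_num) ?_ hx
  filter_upwards [Metric.isOpen_ball.mem_nhds
    (show (1 / 2 : ℂ) ∈ Metric.ball 0 1 by norm_num)] with z hz
  exact mul_integral_mittagLefflerKernel_of_norm_lt_one hα (by simpa using hz)

lemma norm_mittagLefflerKernel_le {α : ℝ} (hα : α ∈ Set.Ioo (0 : ℝ) 1) {x : ℝ} (hx : 0 < x)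
    (ξ : ℝ) : ‖mittagLefflerKernel α x ξ‖ ≤
      x ^ (1 / 8 : ℝ) * (rexp 1 * ‖verticalLine ξ‖ ^ (-(1 + α / 8))) := by
  have hq0 : 0 < ‖verticalLine ξ ^ (α : ℂ)‖ :=
    one_pos.trans_le (one_le_norm_verticalLine_cpow hα.1.le ξ)
  have hre := re_verticalLine_cpow_pos hα ξ
  have hden : ‖verticalLine ξ ^ (α : ℂ)‖ ^ 2 + x ^ 2 ≤
      ‖verticalLine ξ ^ (α : ℂ) + x‖ ^ 2 := by
    simp only [← Complex.normSq_eq_norm_sq, Complex.normSq_apply, Complex.add_re, Complex.add_im,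
      Complex.ofReal_re, Complex.ofReal_im]
    nlinarith
  have h8 : ‖verticalLine ξ‖ ^ (α / 8) = ‖verticalLine ξ ^ (α : ℂ)‖ ^ (1 / 8 : ℝ) := by
    rw [norm_verticalLine_cpow, ← rpow_mul (norm_nonneg _)]
    ring_nf
  rw [← norm_verticalLine_inv_mul, h8, mittagLefflerKernel]
  simp only [norm_mul, norm_div, norm_pow, norm_inv, norm_exp_verticalLine, Complex.norm_real,
    Real.norm_of_nonneg hx.le]
  set Q := ‖verticalLine ξ ^ (α : ℂ)‖
  have hamgm : x ^ (7 / 8 : ℝ) * Q ^ (9 / 8 : ℝ) ≤ Q ^ 2 + x ^ 2 := by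
    have h := Real.geom_mean_le_arith_mean2_weighted (w₁ := 7 / 16) (w₂ := 9 / 16)
      (p₁ := x ^ 2) (p₂ := Q ^ 2) (by norm_num) (by norm_num) (by positivity) (by positivity)
      (by norm_num)
    rw [← rpow_natCast x, ← rpow_natCast Q, ← rpow_mul hx.le, ← rpow_mul hq0.le] at h
    norm_num at h ⊢
    nlinarith [sq_nonneg x, sq_nonneg Q]
  have hfrac : x * Q / ‖verticalLine ξ ^ (α : ℂ) + x‖ ^ 2 ≤
      x ^ (1 / 8 : ℝ) * (Q ^ (1 / 8 : ℝ))⁻¹ := by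
    rw [div_le_iff₀ (lt_of_lt_of_le (by positivity) hden)]
    have hxs : x = x ^ (1 / 8 : ℝ) * x ^ (7 / 8 : ℝ) := by
      rw [← rpow_add hx]; norm_num
    have hQs : Q = (Q ^ (1 / 8 : ℝ))⁻¹ * Q ^ (9 / 8 : ℝ) := by
      rw [← rpow_neg hq0.le, ← rpow_add hq0]; norm_num
    calc x * Q = (x ^ (1 / 8 : ℝ) * x ^ (7 / 8 : ℝ)) *
          ((Q ^ (1 / 8 : ℝ))⁻¹ * Q ^ (9 / 8 : ℝ)) := by rw [← hxs, ← hQs]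
      _ = x ^ (1 / 8 : ℝ) * (Q ^ (1 / 8 : ℝ))⁻¹ * (x ^ (7 / 8 : ℝ) * Q ^ (9 / 8 : ℝ)) := by ring
      _ ≤ _ := by
        gcongr
        exact hamgm.trans hden
  calc _ ≤ rexp 1 * ‖verticalLine ξ‖⁻¹ * (x ^ (1 / 8 : ℝ) * (Q ^ (1 / 8 : ℝ))⁻¹) := by gcongr
    _ = _ := by ring

lemma exists_norm_mittagLeffler_neg_le {α : ℝ} (hα : α ∈ Set.Ioo (0 : ℝ) 1) :
    ∃ C : ℝ, ∀ x : ℝ, 0 < x → x ^ (7 / 8 : ℝ) * ‖mittagLeffler α (-x)‖ ≤ C := by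
  refine ⟨α * ∫ ξ, rexp 1 * ‖verticalLine ξ‖ ^ (-(1 + α / 8)), fun x hx => ?_⟩
  have hI : Integrable fun ξ => rexp 1 * ‖verticalLine ξ‖ ^ (-(1 + α / 8)) :=
    (integrable_norm_verticalLine_rpow (by linarith [hα.1])).const_mul _
  have h := congrArg norm (mul_integral_mittagLefflerKernel hα (x := x) (by simpa using hx))
  rw [norm_mul, norm_mul, Complex.norm_real, Complex.norm_real, Real.norm_of_nonneg hx.le,
    Real.norm_of_nonneg hα.1.le] at h
  have hle : ‖∫ ξ, mittagLefflerKernel α x ξ‖ ≤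
      x ^ (1 / 8 : ℝ) * ∫ ξ, rexp 1 * ‖verticalLine ξ‖ ^ (-(1 + α / 8)) := by
    rw [← integral_const_mul]
    exact norm_integral_le_of_norm_le (hI.const_mul _)
      (Eventually.of_forall (norm_mittagLefflerKernel_le hα hx))
  have hx8 : 0 < x ^ (1 / 8 : ℝ) := rpow_pos_of_pos hx _
  refine le_of_mul_le_mul_left ?_ hx8
  calc x ^ (1 / 8 : ℝ) * (x ^ (7 / 8 : ℝ) * ‖mittagLeffler α (-x)‖)
      = x * ‖mittagLeffler α (-x)‖ := by
        rw [← mul_assoc, ← rpow_add hx]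
        norm_num
    _ = α * ‖∫ ξ, mittagLefflerKernel α x ξ‖ := h.symm
    _ ≤ α * (x ^ (1 / 8 : ℝ) * ∫ ξ, rexp 1 * ‖verticalLine ξ‖ ^ (-(1 + α / 8))) :=
        mul_le_mul_of_nonneg_left hle hα.1.le
    _ = _ := by ring

/-- Weighted summed bound via `E_{α,α}`: there is `C > 0` (depending only on
`α`) such that for every sequence of positive reals `λ_k`, every `(a_k)` with
`∑ a_k² < ∞` and every `t > 0`,
`∑_k λ_k^{7/4} (t^{α-1} E_{α,α}(-λ_k t^α))² a_k² ≤ C t^{α/4 - 2} ∑_k a_k²`. -/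
theorem stmt13 (α : ℝ) (hα : α ∈ Set.Ioo (0 : ℝ) 1)
    (E : ℝ → ℝ) (hE : ∀ x : ℝ, E x = ∑' k : ℕ, x ^ k * (Real.Gamma (α * k + α))⁻¹) :
    ∃ C > 0, ∀ lam : ℕ → ℝ, (∀ k, 0 < lam k) →
      ∀ a : ℕ → ℝ, Summable (fun k => (a k) ^ 2) →
      ∀ t : ℝ, 0 < t →
        ∑' k : ℕ, (lam k) ^ ((7 : ℝ) / 4) * (t ^ (α - 1) * E (-(lam k * t ^ α))) ^ 2 * (a k) ^ 2 ≤
          C * t ^ (α / 4 - 2) * ∑' k : ℕ, (a k) ^ 2 := by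
  obtain ⟨C, hC⟩ := exists_norm_mittagLeffler_neg_le hα
  have hEbound : ∀ x : ℝ, 0 < x → x ^ (7 / 4 : ℝ) * E (-x) ^ 2 ≤ C ^ 2 := by
    intro x hx
    have h := hC x hx
    rw [← Complex.ofReal_neg, mittagLeffler_ofReal, ← hE, Complex.norm_real, Real.norm_eq_abs] at h
    have h2 := pow_le_pow_left₀ (by positivity) h 2
    rw [mul_pow, sq_abs, ← rpow_natCast (x ^ (7 / 8 : ℝ)), ← rpow_mul hx.le] at h2
    norm_num at h2 ⊢
    exact h2
  refine ⟨C ^ 2 + 1, by positivity, fun lam hlam a ha t ht => ?_⟩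
  have hterm : ∀ k, (lam k) ^ ((7 : ℝ) / 4) * (t ^ (α - 1) * E (-(lam k * t ^ α))) ^ 2 *
      (a k) ^ 2 ≤ (C ^ 2 + 1) * t ^ (α / 4 - 2) * (a k) ^ 2 := by
    intro k
    have hl := hlam k
    have htα : 0 < t ^ α := rpow_pos_of_pos ht _
    have hb := hEbound (lam k * t ^ α) (mul_pos hl htα)
    refine mul_le_mul_of_nonneg_right ?_ (sq_nonneg _)
    have hpow : (t ^ (α - 1)) ^ 2 = t ^ (α / 4 - 2) * (t ^ α) ^ (7 / 4 : ℝ) := by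
      rw [← rpow_natCast (t ^ (α - 1)), ← rpow_mul ht.le, ← rpow_mul ht.le, ← rpow_add ht]
      congr 1
      push_cast
      ring
    calc (lam k) ^ ((7 : ℝ) / 4) * (t ^ (α - 1) * E (-(lam k * t ^ α))) ^ 2
        = ((lam k * t ^ α) ^ (7 / 4 : ℝ) * E (-(lam k * t ^ α)) ^ 2) * t ^ (α / 4 - 2) := by
          rw [mul_pow, hpow, mul_rpow hl.le htα.le]
          ring
      _ ≤ (C ^ 2 + 1) * t ^ (α / 4 - 2) := by
          gcongr
          linarith
  have hsum := ha.mul_left ((C ^ 2 + 1) * t ^ (α / 4 - 2))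
  rw [← tsum_mul_left]
  refine Summable.tsum_le_tsum hterm (Summable.of_nonneg_of_le (fun k => ?_) hterm hsum) hsum
  have := (rpow_pos_of_pos (hlam k) ((7 : ℝ) / 4)).le
  positivity
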